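/- Every poset X which is an n-PCM with n ≥ −1 is homogeneous: for every h ∈ X of rank k in X, for every ℓ ∈ {k+1, …, n} there exists an element of rank ℓ in β□_X(h), and for every ℓ ∈ {0, …, k−1} there exists an element of rank ℓ in α□_X(h). -/

import Mathlib

namespace PCMPaper

variable {α : Type*} [PartialOrder α]

/-- The set of elements of `X` strictly below `h` (α□_X(h)). -/
def alphaS (X : Set α) (h : α) : Set α := {x ∈ X | x < h}

/-- The set of elements of `X` strictly above `h` (β□_X(h)). -/
def betaS (X : Set α) (h : α) : Set α := {x ∈ X | h < x}

/-- The (strict) neighborhood θ□_X(h) = α□_X(h) ∪ β□_X(h). -/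
def thetaS (X : Set α) (h : α) : Set α := alphaS X h ∪ betaS X h

/-- The rank of `h` in the poset `X`: the maximal length of a strictly increasing
chain in `X` ending at `h`.  (It equals 0 when α□_X(h) = ∅ and
`max_{x ∈ α□_X(h)} rank X x + 1` otherwise, for finite `X`.) -/
noncomputable def rank (X : Set α) (h : α) : ℕ :=
  sSup {n : ℕ | ∃ c : Fin (n + 1) → α, StrictMono c ∧ (∀ i, c i ∈ X) ∧ c (Fin.last n) = h}

open scoped Classical in
/-- The rank of the poset `X`: maximal rank of its elements, `-1` if empty. -/
noncomputable def rankSet (X : Set α) : ℤ :=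
  if X = ∅ then -1 else ((sSup (rank X '' X) : ℕ) : ℤ)

/-- One step of a path in `X`: two distinct comparable elements of `X`. -/
def rel (X : Set α) (x y : α) : Prop :=
  x ∈ X ∧ y ∈ X ∧ x ≠ y ∧ (x < y ∨ y < x)

/-- `X` is (path-)connected: any two elements are joined by a path in `X`. -/
def IsConnected (X : Set α) : Prop :=
  ∀ x ∈ X, ∀ y ∈ X, Relation.ReflTransGen (rel X) x y

/-- `IsSurfaceAux (k + 1) X` means that `X` is a (discrete) `k`-surface. -/
def IsSurfaceAux : ℕ → Set α → Prop
  | 0, X => X = ∅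
  | 1, X => ∃ x y : α, x ≠ y ∧ ¬ x < y ∧ ¬ y < x ∧ X = {x, y}
  | (n + 2), X => X.Nonempty ∧ IsConnected X ∧ ∀ h ∈ X, IsSurfaceAux (n + 1) (thetaS X h)

/-- `X` is a discrete `k`-surface (`k : ℤ`, `k ≥ -1`). -/
def IsSurface (k : ℤ) (X : Set α) : Prop :=
  ∃ n : ℕ, (n : ℤ) = k + 1 ∧ IsSurfaceAux n X

/-- The border ΔX of a poset `X` of rank `n`:
elements whose neighborhood is not an `(n-1)`-surface. -/
def border (X : Set α) : Set α :=
  {h ∈ X | ¬ IsSurface (rankSet X - 1) (thetaS X h)}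

/-- The interior of `X`. -/
def interior' (X : Set α) : Set α := X \ border X

/-- `IsPCMAux (n + 1) X` means that `X` is an `n`-PCM. -/
def IsPCMAux : ℕ → Set α → Prop
  | 0, X => X = ∅
  | 1, X => ∃ x : α, X = {x}
  | (n + 2), X => rankSet X = ((n : ℤ) + 1) ∧ IsConnected X ∧ border X ≠ ∅ ∧
      ∀ h ∈ X, (h ∈ border X → IsPCMAux (n + 1) (thetaS X h)) ∧
               (h ∉ border X → IsSurfaceAux (n + 1) (thetaS X h))

/-- `X` is an `k`-PCM (`k : ℤ`, `k ≥ -1`). -/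
def IsPCM (k : ℤ) (X : Set α) : Prop :=
  ∃ n : ℕ, (n : ℤ) = k + 1 ∧ IsPCMAux n X

/-- Fuel-indexed coherence. -/
def IsCoherentAux : ℕ → Set α → Prop
  | 0, X => X = ∅
  | (n + 1), X => X = ∅ ∨
      ∀ h ∈ X, rankSet (thetaS X h) = rankSet X - 1 ∧ IsCoherentAux n (thetaS X h)

/-- `X` is a coherent poset. -/
def IsCoherent (X : Set α) : Prop := ∃ n : ℕ, IsCoherentAux n X

/-- `X` is a separated union of `(m-1)`-surfaces: a union of `(m-1)`-surfaces such
that no element of one of them is comparable to an element of another one. -/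
def IsSeparatedUnionOfSurfacesAux (m : ℕ) (X : Set α) : Prop :=
  ∃ P : Set (Set α), P.Nonempty ∧ X = ⋃₀ P ∧ (∀ S ∈ P, IsSurfaceAux m S) ∧
    ∀ S ∈ P, ∀ T ∈ P, S ≠ T → ∀ x ∈ S, ∀ y ∈ T, ¬ x ≤ y ∧ ¬ y ≤ x

/-- `IsSmoothPCMAux (n + 1) X` means that `X` is a smooth `n`-PCM. -/
def IsSmoothPCMAux : ℕ → Set α → Prop
  | 0, X => X = ∅
  | 1, X => ∃ x : α, X = {x}
  | (n + 2), X => rankSet X = ((n : ℤ) + 1) ∧ IsConnected X ∧ border X ≠ ∅ ∧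
      IsSeparatedUnionOfSurfacesAux (n + 1) (border X) ∧
      ∀ h ∈ X, IsSurfaceAux (n + 1) (thetaS X h) ∨ IsSmoothPCMAux (n + 1) (thetaS X h)

/-- `X` is a smooth `k`-PCM (`k : ℤ`, `k ≥ -1`). -/
def IsSmoothPCM (k : ℤ) (X : Set α) : Prop :=
  ∃ n : ℕ, (n : ℤ) = k + 1 ∧ IsSmoothPCMAux n X

/-- A simplicial complex: a finite family of nonempty finite sets, closed under
taking nonempty subsets and under nonempty intersections. -/
def IsSimplicialComplex {V : Type*} [DecidableEq V] (X : Set (Finset V)) : Prop :=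
  X.Finite ∧ (∀ h ∈ X, h.Nonempty) ∧
  (∀ h ∈ X, ∀ h' : Finset V, h'.Nonempty → h' ⊆ h → h' ∈ X) ∧
  (∀ h ∈ X, ∀ h' ∈ X, (h ∩ h').Nonempty → h ∩ h' ∈ X)

/-- The dimension of a simplex. -/
def dim {V : Type*} (h : Finset V) : ℤ := (h.card : ℤ) - 1

/-- The link of a simplex `h` in a family of simplices `S`. -/
def link {V : Type*} [DecidableEq V] (h : Finset V) (S : Set (Finset V)) : Set (Finset V) :=
  {h' ∈ S | h ∩ h' = ∅ ∧ h ∪ h' ∈ S}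

/-- `X` is pure of rank `n`: every simplex is contained in an `n`-dimensional one. -/
def Pure {V : Type*} (X : Set (Finset V)) (n : ℤ) : Prop :=
  ∀ h ∈ X, ∃ g ∈ X, h ⊆ g ∧ dim g = n

/-- Any two `n`-simplices of `X` are joined by a path in `X` all of whose elements
are simplices of dimension `n - 1` or `n` (i.e. `X` is `(n-1)`-connected). -/
def NConnected {V : Type*} (X : Set (Finset V)) (n : ℤ) : Prop :=
  ∀ a ∈ X, dim a = n → ∀ b ∈ X, dim b = n →
    Relation.ReflTransGen (rel {h | h ∈ X ∧ (dim h = n - 1 ∨ dim h = n)}) a b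

/-- `X` is a pseudomanifold of rank `n`. -/
def IsPseudomanifold {V : Type*} [DecidableEq V] (X : Set (Finset V)) (n : ℤ) : Prop :=
  IsSimplicialComplex X ∧ rankSet X = n ∧
  ((n = 0 ∧ ∃ v : V, X = {({v} : Finset V)}) ∨
   (1 ≤ n ∧ Pure X n ∧
    (∀ h ∈ X, dim h = n - 1 →
      Set.ncard {g | g ∈ X ∧ h ⊆ g ∧ dim g = n} ∈ ({1, 2} : Set ℕ)) ∧
    NConnected X n))

/-- `X` is a normal pseudomanifold of rank `n`: a pseudomanifold such that the link
of every simplex of dimension at most `n - 2` is a pseudomanifold. -/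
def IsNormalPseudomanifold {V : Type*} [DecidableEq V] (X : Set (Finset V)) (n : ℤ) : Prop :=
  IsPseudomanifold X n ∧
  ∀ h ∈ X, dim h ≤ n - 2 → IsPseudomanifold (link h X) (n - dim h - 1)

/-- `C` is a maximal chain of the poset `X`. -/
structure IsMaxChainIn (X C : Set α) : Prop where
  subset : C ⊆ X
  isChain : IsChain (· ≤ ·) C
  mem_of_comparable : ∀ x ∈ X, (∀ y ∈ C, x ≤ y ∨ y ≤ x) → x ∈ C

theorem exists_isMaxChainIn_superset {X C : Set α} (hX : X.Finite) (hCX : C ⊆ X)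
    (hC : IsChain (· ≤ ·) C) : ∃ D, IsMaxChainIn X D ∧ C ⊆ D := by
  have hfin : {D : Set α | D ⊆ X ∧ IsChain (· ≤ ·) D}.Finite :=
    hX.finite_subsets.subset fun D hD => hD.1
  obtain ⟨D, hCD, hD⟩ := hfin.exists_le_maximal (a := C) ⟨hCX, hC⟩
  refine ⟨D, ⟨hD.prop.1, hD.prop.2, fun x hx hxD => ?_⟩, hCD⟩
  have hins : IsChain (· ≤ ·) (insert x D) := hD.prop.2.insert fun y hy _ => hxD y hy
  exact hD.le_of_ge ⟨Set.insert_subset hx hD.prop.1, hins⟩ (Set.subset_insert x D)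
    (Set.mem_insert x D)

theorem IsMaxChainIn.nonempty {X C : Set α} (hC : IsMaxChainIn X C) (hX : X.Nonempty) :
    C.Nonempty := by
  by_contra hne
  obtain ⟨x, hx⟩ := hX
  rw [Set.not_nonempty_iff_eq_empty] at hne
  subst hne
  exact hC.mem_of_comparable x hx (by simp)

/-- Removing an element `h` from a maximal chain of `X` leaves a maximal chain of `θ□_X(h)`. -/
theorem IsMaxChainIn.diff_singleton {X C : Set α} (hC : IsMaxChainIn X C) {h : α}
    (hh : h ∈ C) : IsMaxChainIn (thetaS X h) (C \ {h}) where
  subset := by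
    rintro x ⟨hxC, hxh⟩
    rcases hC.isChain.total hxC hh with hle | hle
    · exact Or.inl ⟨hC.subset hxC, lt_of_le_of_ne hle hxh⟩
    · exact Or.inr ⟨hC.subset hxC, lt_of_le_of_ne hle (Ne.symm hxh)⟩
  isChain := hC.isChain.mono Set.sdiff_subset
  mem_of_comparable := by
    intro x hx hcomp
    have hxX : x ∈ X := hx.elim (·.1) (·.1)
    have hxh : x ≠ h := hx.elim (·.2.ne) (·.2.ne')
    refine ⟨hC.mem_of_comparable x hxX fun y hy => ?_, hxh⟩
    by_cases hyh : y = h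
    · subst hyh
      exact hx.imp (·.2.le) (·.2.le)
    · exact hcomp y ⟨hy, hyh⟩

/-- If every neighborhood in a finite nonempty poset has all maximal chains of cardinality `m`,
then all maximal chains of the poset have cardinality `m + 1`. -/
theorem IsMaxChainIn.ncard_eq_add_one {X C : Set α} (hX : X.Finite) (hne : X.Nonempty) {m : ℕ}
    (hm : ∀ h ∈ X, ∀ D, IsMaxChainIn (thetaS X h) D → D.ncard = m) (hC : IsMaxChainIn X C) :
    C.ncard = m + 1 := by
  obtain ⟨h, hh⟩ := hC.nonempty hne
  rw [← Set.ncard_sdiff_singleton_add_one hh (hX.subset hC.subset),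
    hm h (hC.subset hh) _ (hC.diff_singleton hh)]

theorem thetaS_subset (X : Set α) (h : α) : thetaS X h ⊆ X :=
  Set.union_subset (Set.sep_subset _ _) (Set.sep_subset _ _)

theorem IsSurfaceAux.ncard_eq {m : ℕ} {X C : Set α} (hfin : X.Finite) (hX : IsSurfaceAux m X)
    (hC : IsMaxChainIn X C) : C.ncard = m := by
  induction m using Nat.twoStepInduction generalizing X C with
  | zero =>
    have hX' : X = ∅ := hX
    subst hX'
    simp [Set.subset_empty_iff.mp hC.subset]
  | one =>
    obtain ⟨x, y, hxy, hlt, hgt, rfl⟩ := hX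
    refine hC.ncard_eq_add_one hfin ⟨x, by simp⟩ fun h hh D hD => ?_
    have hempty : thetaS {x, y} h = ∅ := by
      ext z
      rcases hh with rfl | rfl <;> simp only [thetaS, alphaS, betaS, Set.mem_union, Set.mem_ofPred_eq,
        Set.mem_insert_iff, Set.mem_singleton_iff, Set.mem_empty_iff_false] <;> grind
    rw [Set.subset_empty_iff.mp (hD.subset.trans hempty.subset), Set.ncard_empty]
  | more n _ ih =>
    exact hC.ncard_eq_add_one hfin hX.1 fun h hh D hD =>
      ih (hfin.subset (thetaS_subset X h)) (hX.2.2 h hh) hD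

/-- All maximal chains of an `(m - 1)`-PCM have `m` elements. -/
theorem IsPCMAux.ncard_eq {m : ℕ} {X C : Set α} (hfin : X.Finite) (hX : IsPCMAux m X)
    (hC : IsMaxChainIn X C) : C.ncard = m := by
  induction m using Nat.twoStepInduction generalizing X C with
  | zero =>
    have hX' : X = ∅ := hX
    subst hX'
    simp [Set.subset_empty_iff.mp hC.subset]
  | one =>
    obtain ⟨x, rfl⟩ := hX
    rw [(hC.nonempty ⟨x, rfl⟩).subset_singleton_iff.mp hC.subset, Set.ncard_singleton]
  | more n _ ih =>
    obtain ⟨hrank, -, -, htheta⟩ := hX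
    have hne : X.Nonempty := by
      by_contra hne
      rw [rankSet, if_pos (Set.not_nonempty_iff_eq_empty.mp hne)] at hrank
      omega
    refine hC.ncard_eq_add_one hfin hne fun h hh D hD => ?_
    have hfin' := hfin.subset (thetaS_subset X h)
    by_cases hb : h ∈ border X
    · exact ih hfin' ((htheta h hh).1 hb) hD
    · exact ((htheta h hh).2 hb).ncard_eq hfin' hD

theorem exists_strictMono_range_eq {C : Set α} (hC : IsChain (· ≤ ·) C) (hfin : C.Finite) :
    ∃ d : Fin C.ncard → α, StrictMono d ∧ Set.range d = C := by
  classical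
  let _ : LinearOrder C :=
    { (inferInstance : PartialOrder C) with
      le_total := fun a b => hC.total a.2 b.2
      toDecidableLE := Classical.decRel _ }
  have : Fintype C := hfin.fintype
  let e := Fintype.orderIsoFinOfCardEq C (k := C.ncard) (by
    rw [← Nat.card_coe_set_eq, Nat.card_eq_fintype_card])
  refine ⟨fun i => (e i : α), fun i j hij => e.strictMono hij, ?_⟩
  ext x
  exact ⟨fun ⟨i, hi⟩ => hi ▸ (e i).2, fun hx => ⟨e.symm ⟨x, hx⟩, by simp⟩⟩

/-- In a poset all of whose chains have at most `m` elements, the rank of the element of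
index `i` of a chain with `m` elements is `i`. -/
theorem rank_eq_of_strictMono {X : Set α} {m : ℕ}
    (hm : ∀ C ⊆ X, IsChain (· ≤ ·) C → C.ncard ≤ m) {d : Fin m → α} (hd : StrictMono d)
    (hdX : ∀ i, d i ∈ X) (i : Fin m) : rank X (d i) = i := by
  refine IsGreatest.csSup_eq ⟨⟨d ∘ Fin.castLE i.isLt, ?_, fun j => hdX _, rfl⟩, ?_⟩
  · exact hd.comp (Fin.strictMono_castLE i.isLt)
  rintro k ⟨c, hc, hcX, hck⟩
  have hbelow : ∀ a, c a ≤ d i := fun a => hck ▸ hc.monotone (Fin.le_last a)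
  have hcross : ∀ a, ∀ j ∈ Set.Ioi i, c a < d j := fun a j hj => (hbelow a).trans_lt (hd hj)
  have hchain : IsChain (· ≤ ·) (Set.range c ∪ d '' Set.Ioi i) := by
    rintro _ (⟨a, rfl⟩ | ⟨a, ha, rfl⟩) _ (⟨b, rfl⟩ | ⟨b, hb, rfl⟩) -
    · exact (le_total a b).imp (hc.monotone ·) (hc.monotone ·)
    · exact Or.inl (hcross a b hb).le
    · exact Or.inr (hcross b a ha).le
    · exact (le_total a b).imp (hd.monotone ·) (hd.monotone ·)
  have hdisj : Disjoint (Set.range c) (d '' Set.Ioi i) := by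
    rw [Set.disjoint_left]
    rintro _ ⟨a, rfl⟩ ⟨j, hj, hja⟩
    exact (hcross a j hj).ne' hja
  have hcard := hm _ (Set.union_subset (Set.range_subset_iff.mpr hcX)
    (Set.image_subset_iff.mpr fun j _ => hdX j)) hchain
  have hrange : (Set.range c).ncard = k + 1 := by
    rw [← Set.image_univ, Set.ncard_image_of_injective _ hc.injective, Set.ncard_univ,
      Nat.card_fin]
  have htail : (Set.Ioi i).ncard = m - 1 - i := by
    rw [← Finset.coe_Ioi, Set.ncard_coe_finset, Fin.card_Ioi]
  rw [Set.ncard_union_eq hdisj (Set.toFinite _) (Set.toFinite _), hrange,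
    Set.ncard_image_of_injective _ hd.injective, htail] at hcard
  have := i.isLt
  omega

/-- Every (finite) poset which is an `n`-PCM with `n ≥ -1` is homogeneous. -/
theorem statement_2 {α : Type*} [PartialOrder α] (X : Set α) (hfin : X.Finite)
    (n : ℤ) (hn : -1 ≤ n) (hpcm : IsPCM n X) :
    ∀ h ∈ X,
      (∀ l : ℕ, rank X h + 1 ≤ l → (l : ℤ) ≤ n → ∃ g ∈ betaS X h, rank X g = l) ∧
      (∀ l : ℕ, l < rank X h → ∃ g ∈ alphaS X h, rank X g = l) := by
  obtain ⟨m, hmn, hX⟩ := hpcm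
  intro h hh
  have hbound : ∀ C ⊆ X, IsChain (· ≤ ·) C → C.ncard ≤ m := fun C hCX hC => by
    obtain ⟨D, hD, hCD⟩ := exists_isMaxChainIn_superset hfin hCX hC
    exact (Set.ncard_le_ncard hCD (hfin.subset hD.subset)).trans_eq (hX.ncard_eq hfin hD)
  obtain ⟨C, hC, hhC⟩ := exists_isMaxChainIn_superset hfin (Set.singleton_subset_iff.mpr hh)
    (IsChain.singleton (r := (· ≤ ·)) (a := h))
  obtain ⟨d, hd, hdC⟩ := exists_strictMono_range_eq hC.isChain (hfin.subset hC.subset)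
  obtain rfl : C.ncard = m := hX.ncard_eq hfin hC
  have hdX : ∀ i, d i ∈ X := fun i => hC.subset (hdC ▸ Set.mem_range_self i)
  have hrank := rank_eq_of_strictMono hbound hd hdX
  obtain ⟨i, rfl⟩ : h ∈ Set.range d := hdC.symm ▸ hhC rfl
  rw [hrank i]
  refine ⟨fun l hil hln => ?_, fun l hli => ?_⟩
  · let j : Fin C.ncard := ⟨l, by omega⟩
    exact ⟨d j, ⟨hdX j, hd (show i < j from hil)⟩, hrank j⟩
  · let j : Fin C.ncard := ⟨l, hli.trans i.isLt⟩
    exact ⟨d j, ⟨hdX j, hd (show j < i from hli)⟩, hrank j⟩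

end PCMPaper
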